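/- arXiv:1208.4854 — 4 statements merged into one kernel-verified Lean document; each statement's English description precedes it below -/
import Mathlib

section
/- For all integers n ≥ 2 and 2 ≤ j ≤ 2n−1, the counts a(n,j) satisfy the recurrence a(n,j) = (2n−1−j)·a(n−1,j) + (j−1)·a(n−1,j−1). -/
open scoped Classical

/-- A deal of size `n` is a fixed-point-free involution of `Fin (2*n)`. -/
def IsDeal (n : ℕ) (π : Fin (2*n) → Fin (2*n)) : Prop :=
  ∀ j, π (π j) = j ∧ π j ≠ j

/-- The finite set `D_n` of all deals of size `n`. -/
noncomputable def deals (n : ℕ) : Finset (Fin (2*n) → Fin (2*n)) :=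
  Finset.univ.filter (IsDeal n)

/-- `f(π)`: the 1-indexed position of the first card matching an earlier card,
i.e. `1 + min { j : π j < j }` (positions 0-indexed). -/
noncomputable def firstMatch {n : ℕ} (π : Fin (2*n) → Fin (2*n)) : ℕ :=
  1 + sInf {j : ℕ | ∃ h : j < 2*n, (π ⟨j, h⟩).val < j}

/-- `a(n,j)`: the number of deals `π ∈ D_n` with `f(π) = j`. -/
noncomputable def a (n j : ℕ) : ℕ :=
  ((deals n).filter (fun π => firstMatch π = j)).card

/-- The embedding of `Fin N` into `Fin (N + 2)` that omits `p` and the last position. -/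
def skipTwo {N : ℕ} (p : Fin (N + 1)) (i : Fin N) : Fin (N + 2) :=
  (p.succAbove i).castSucc

/-- The map on `Fin (N + 2)` that swaps `p` with the last position and acts as `σ` elsewhere. -/
def insertPair {N : ℕ} (p : Fin (N + 1)) (σ : Fin N → Fin N) : Fin (N + 2) → Fin (N + 2) :=
  Fin.snoc (α := fun _ => Fin (N + 2))
    (p.insertNth (α := fun _ => Fin (N + 2)) (Fin.last (N + 1)) fun i => skipTwo p (σ i))
    p.castSucc

section InsertPair

variable {N : ℕ} (p : Fin (N + 1)) (σ : Fin N → Fin N)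

theorem skipTwo_strictMono : StrictMono (skipTwo p) := fun _ _ h =>
  Fin.castSucc_lt_castSucc_iff.2 (Fin.strictMono_succAbove p h)

theorem skipTwo_ne_last (i : Fin N) : skipTwo p i ≠ Fin.last (N + 1) :=
  Fin.castSucc_ne_last _

theorem skipTwo_ne_castSucc (i : Fin N) : skipTwo p i ≠ p.castSucc := fun h =>
  Fin.succAbove_ne p i (Fin.castSucc_injective _ h)

theorem skipTwo_val (i : Fin N) :
    (skipTwo p i).val = if p.val ≤ i.val then i.val + 1 else i.val := by
  simp only [skipTwo, Fin.succAbove, Fin.lt_def, Fin.val_castSucc]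
  split_ifs <;> simp <;> omega

theorem eq_last_or_eq_castSucc_or_eq_skipTwo (x : Fin (N + 2)) :
    x = Fin.last (N + 1) ∨ x = p.castSucc ∨ ∃ i, x = skipTwo p i := by
  induction x using Fin.lastCases with
  | last => exact Or.inl rfl
  | cast y =>
    rcases Fin.eq_self_or_eq_succAbove p y with rfl | ⟨i, rfl⟩
    · exact Or.inr (Or.inl rfl)
    · exact Or.inr (Or.inr ⟨i, rfl⟩)

@[simp]
theorem insertPair_last : insertPair p σ (Fin.last (N + 1)) = p.castSucc := by
  simp [insertPair]

@[simp]
theorem insertPair_castSucc : insertPair p σ p.castSucc = Fin.last (N + 1) := by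
  simp only [insertPair, Fin.snoc_castSucc, Fin.insertNth_apply_same]

@[simp]
theorem insertPair_skipTwo (i : Fin N) : insertPair p σ (skipTwo p i) = skipTwo p (σ i) := by
  rw [insertPair, skipTwo, Fin.snoc_castSucc, Fin.insertNth_apply_succAbove]

theorem insertPair_injective :
    Function.Injective fun x : Fin (N + 1) × (Fin N → Fin N) => insertPair x.1 x.2 := by
  rintro ⟨p, σ⟩ ⟨q, τ⟩ h
  have hpq : p = q := Fin.castSucc_injective _ (by simpa using congrFun h (Fin.last (N + 1)))
  subst hpq
  refine Prod.ext rfl (funext fun i => (skipTwo_strictMono p).injective ?_)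
  simpa using congrFun h (skipTwo p i)

variable {σ} in
theorem insertPair_involution (hσ : ∀ i, σ (σ i) = i ∧ σ i ≠ i) (x : Fin (N + 2)) :
    insertPair p σ (insertPair p σ x) = x ∧ insertPair p σ x ≠ x := by
  rcases eq_last_or_eq_castSucc_or_eq_skipTwo p x with rfl | rfl | ⟨i, rfl⟩
  · simp
  · simpa using (Fin.castSucc_ne_last p).symm
  · simpa [(hσ i).1] using (skipTwo_strictMono p).injective.ne (hσ i).2

theorem exists_eq_insertPair {π : Fin (N + 2) → Fin (N + 2)}
    (hπ : ∀ x, π (π x) = x ∧ π x ≠ x) :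
    ∃ (p : Fin (N + 1)) (σ : Fin N → Fin N),
      (∀ i, σ (σ i) = i ∧ σ i ≠ i) ∧ insertPair p σ = π := by
  obtain ⟨p, hp⟩ := Fin.exists_castSucc_eq.2 (hπ (Fin.last (N + 1))).2
  have hp' : π p.castSucc = Fin.last (N + 1) := by rw [hp, (hπ _).1]
  have hskip (i : Fin N) : ∃ k, π (skipTwo p i) = skipTwo p k := by
    rcases eq_last_or_eq_castSucc_or_eq_skipTwo p (π (skipTwo p i)) with h | h | h
    · exact absurd (by rw [hp, ← h, (hπ _).1]) (skipTwo_ne_castSucc p i)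
    · exact absurd (by rw [← hp', ← h, (hπ _).1]) (skipTwo_ne_last p i)
    · exact h
  choose σ hσ using hskip
  refine ⟨p, σ, fun i => ⟨(skipTwo_strictMono p).injective ?_, fun h => ?_⟩, funext fun x => ?_⟩
  · rw [← hσ, ← hσ, (hπ _).1]
  · exact (hπ (skipTwo p i)).2 (by rw [hσ, h])
  · rcases eq_last_or_eq_castSucc_or_eq_skipTwo p x with rfl | rfl | ⟨i, rfl⟩
    · simp [hp]
    · simp [hp']
    · simp [hσ]

theorem isLeast_insertPair {k : Fin N} (hk : IsLeast {i | σ i < i} k) :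
    IsLeast {x | insertPair p σ x < x} (skipTwo p k) := by
  refine ⟨by simpa using skipTwo_strictMono p hk.1, fun x hx => ?_⟩
  rcases eq_last_or_eq_castSucc_or_eq_skipTwo p x with rfl | rfl | ⟨i, rfl⟩
  · exact Fin.le_last _
  · simp only [Set.mem_ofPred_eq, insertPair_castSucc] at hx
    exact absurd hx (Fin.le_last _).not_gt
  · simp only [Set.mem_ofPred_eq, insertPair_skipTwo, (skipTwo_strictMono p).lt_iff_lt] at hx
    exact (skipTwo_strictMono p).monotone (hk.2 hx)

end InsertPair

theorem firstMatch_eq_of_isLeast {n : ℕ} {π : Fin (2 * n) → Fin (2 * n)} {k : Fin (2 * n)}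
    (hk : IsLeast {i | π i < i} k) : firstMatch π = 1 + k.val := by
  have : IsLeast {j : ℕ | ∃ h : j < 2 * n, (π ⟨j, h⟩).val < j} k.val :=
    ⟨⟨k.2, hk.1⟩, by
      rintro j ⟨h, hj⟩
      exact hk.2 (show (⟨j, h⟩ : Fin (2 * n)) ∈ {i | π i < i} from hj)⟩
  rw [firstMatch, this.csInf_eq]

theorem IsDeal.exists_isLeast {n : ℕ} (hn : 0 < n) {π : Fin (2 * n) → Fin (2 * n)}
    (hπ : IsDeal n π) : ∃ k, IsLeast {i | π i < i} k := by
  have hne : {i | π i < i}.Nonempty := by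
    rcases lt_or_gt_of_ne (hπ ⟨0, by omega⟩).2 with h | h
    · exact ⟨_, h⟩
    · exact ⟨π ⟨0, by omega⟩, by simpa [(hπ _).1] using h⟩
  exact ⟨_, WellFounded.min_mem wellFounded_lt _ hne,
    fun i hi => not_lt.1 (WellFounded.not_lt_min wellFounded_lt _ hi)⟩

theorem firstMatch_insertPair {m : ℕ} (hm : 0 < m) (p : Fin (2 * m + 1))
    {σ : Fin (2 * m) → Fin (2 * m)} (hσ : IsDeal m σ) :
    firstMatch (n := m + 1) (insertPair p σ) =
      if p.val < firstMatch σ then firstMatch σ + 1 else firstMatch σ := by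
  obtain ⟨k, hk⟩ := hσ.exists_isLeast hm
  rw [firstMatch_eq_of_isLeast hk,
    firstMatch_eq_of_isLeast (n := m + 1) (isLeast_insertPair p σ hk), skipTwo_val]
  split_ifs <;> omega

theorem deals_succ (m : ℕ) :
    deals (m + 1) = ((Finset.univ : Finset (Fin (2 * m + 1))) ×ˢ deals m).image
      fun x => insertPair x.1 x.2 := by
  ext π
  simp only [deals, Finset.mem_filter, Finset.mem_univ, true_and, Finset.mem_image,
    Finset.mem_product, Prod.exists]
  constructor
  · exact fun h => exists_eq_insertPair (N := 2 * m) h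
  · rintro ⟨p, σ, hσ, rfl⟩
    exact insertPair_involution p hσ

theorem a_succ {m : ℕ} (hm : 0 < m) {j : ℕ} (hj2 : 2 ≤ j) (hj : j ≤ 2 * m + 1) :
    a (m + 1) j = (2 * m + 1 - j) * a m j + (j - 1) * a m (j - 1) := by
  have hsplit : ((Finset.univ : Finset (Fin (2 * m + 1))) ×ˢ deals m).filter
        (fun x => firstMatch (n := m + 1) (insertPair x.1 x.2) = j) =
      (Finset.univ.filter fun p : Fin (2 * m + 1) => ¬ p.val < j) ×ˢ
          (deals m).filter (fun σ => firstMatch σ = j) ∪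
        (Finset.univ.filter fun p : Fin (2 * m + 1) => p.val < j - 1) ×ˢ
          (deals m).filter (fun σ => firstMatch σ = j - 1) := by
    ext ⟨p, σ⟩
    simp only [Finset.mem_filter, Finset.mem_product, Finset.mem_univ, true_and,
      Finset.mem_union]
    by_cases hσ : σ ∈ deals m
    · rw [firstMatch_insertPair hm p (Finset.mem_filter.1 hσ).2]
      simp only [hσ, true_and]
      split_ifs <;> omega
    · simp [hσ]
  have hdisj : Disjoint
      ((Finset.univ.filter fun p : Fin (2 * m + 1) => ¬ p.val < j) ×ˢ
        (deals m).filter (fun σ => firstMatch σ = j))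
      ((Finset.univ.filter fun p : Fin (2 * m + 1) => p.val < j - 1) ×ˢ
        (deals m).filter (fun σ => firstMatch σ = j - 1)) := by
    refine Finset.disjoint_product.2 (Or.inr (Finset.disjoint_filter.2 fun _ _ _ => ?_))
    omega
  have hlt {c : ℕ} (hc : c ≤ 2 * m + 1) :
      (Finset.univ.filter fun p : Fin (2 * m + 1) => p.val < c).card = c := by
    rw [Fin.card_filter_val_lt, min_eq_right hc]
  have hge : (Finset.univ.filter fun p : Fin (2 * m + 1) => ¬ p.val < j).card =
      2 * m + 1 - j := by
    have := Finset.card_filter_add_card_filter_not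
      (s := (Finset.univ : Finset (Fin (2 * m + 1)))) (fun p => p.val < j)
    rw [hlt hj, Finset.card_univ, Fintype.card_fin] at this
    omega
  rw [a, deals_succ, Finset.filter_image,
    Finset.card_image_of_injective _ (insertPair_injective (N := 2 * m)), hsplit,
    Finset.card_union_of_disjoint hdisj, Finset.card_product, Finset.card_product, hge,
    hlt (by omega)]
  rfl

/-- For `n ≥ 2` and `2 ≤ j ≤ 2n-1`,
`a(n,j) = (2n-1-j)·a(n-1,j) + (j-1)·a(n-1,j-1)`. -/
theorem a_recurrence (n j : ℕ) (hn : 2 ≤ n) (hj2 : 2 ≤ j) (hj : j ≤ 2*n - 1) :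
    a n j = (2*n - 1 - j) * a (n-1) j + (j - 1) * a (n-1) (j-1) := by
  obtain ⟨m, rfl⟩ : ∃ m, n = m + 1 := ⟨n - 1, by omega⟩
  have h := a_succ (m := m) (by omega) hj2 (by omega)
  rwa [show 2 * (m + 1) - 1 - j = 2 * m + 1 - j by omega, Nat.add_sub_cancel]
end

section
/- For every integer n ≥ 1, the sum of f(π) over all deals π ∈ D_n equals 2^n · n!. -/
open scoped Classical

/-- The involutions of `α` that move exactly the points of `T` and match no two points of `S`. -/
noncomputable def crossPairings {α : Type*} [Fintype α] (T S : Finset α) : Finset (α → α) :=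
  Finset.univ.filter fun π => (∀ j, π (π j) = j) ∧ (∀ j, π j ≠ j ↔ j ∈ T) ∧ ∀ j ∈ S, π j ∉ S

theorem mem_crossPairings {α : Type*} [Fintype α] {T S : Finset α} {π : α → α} :
    π ∈ crossPairings T S ↔
      (∀ j, π (π j) = j) ∧ (∀ j, π j ≠ j ↔ j ∈ T) ∧ ∀ j ∈ S, π j ∉ S := by
  simp [crossPairings]

/-- Removing a matched pair `s, t` from an involution. -/
theorem card_crossPairings_filter_apply_eq {α : Type*} [Fintype α] {T S : Finset α} {s t : α}
    (hsT : s ∈ T) (hsS : s ∉ S) (ht : t ∈ T \ insert s S) :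
    ((crossPairings T (insert s S)).filter fun π => π s = t).card =
      (crossPairings (T \ {s, t}) S).card := by
  simp only [Finset.mem_sdiff, Finset.mem_insert, not_or] at ht
  obtain ⟨htT, hts, htS⟩ := ht
  refine Finset.card_bij' (fun π _ j => Equiv.swap s t (π j)) (fun π _ j => Equiv.swap s t (π j))
    ?_ ?_ (by intros; simp) (by intros; simp)
  · intro π hπ
    simp only [Finset.mem_filter, mem_crossPairings, Finset.mem_insert] at hπ
    obtain ⟨⟨hinv, hsupp, hS⟩, hst⟩ := hπ
    have hts' : π t = s := by rw [← hst, hinv]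
    simp only [mem_crossPairings, Finset.mem_sdiff, Finset.mem_insert, Finset.mem_singleton,
      Equiv.swap_apply_def]
    refine ⟨fun j => ?_, fun j => ?_, fun j hj => ?_⟩
    · grind
    · grind
    · grind
  · intro π hπ
    simp only [mem_crossPairings, Finset.mem_sdiff, Finset.mem_insert,
      Finset.mem_singleton] at hπ
    obtain ⟨hinv, hsupp, hS⟩ := hπ
    have hs : π s = s := by by_contra h; simpa using (hsupp s).1 h
    have ht : π t = t := by by_contra h; simpa using (hsupp t).1 h
    simp only [Finset.mem_filter, mem_crossPairings, Finset.mem_insert, Equiv.swap_apply_def]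
    refine ⟨⟨fun j => ?_, fun j => ?_, fun j hj => ?_⟩, by simp [hs]⟩
    · grind
    · grind
    · grind

theorem card_crossPairings_insert {α : Type*} [Fintype α] {T S : Finset α} {s : α}
    (hsT : s ∈ T) (hsS : s ∉ S) :
    (crossPairings T (insert s S)).card =
      ∑ t ∈ T \ insert s S, (crossPairings (T \ {s, t}) S).card := by
  rw [Finset.card_eq_sum_card_fiberwise (f := fun π => π s) (t := T \ insert s S)]
  · exact Finset.sum_congr rfl fun t ht => card_crossPairings_filter_apply_eq hsT hsS ht
  · intro π hπ
    obtain ⟨hinv, hsupp, hS⟩ := mem_crossPairings.1 (Finset.mem_coe.1 hπ)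
    have := (hsupp s).2 hsT
    have h2 := (hsupp (π s)).1 (by rw [hinv]; exact this.symm)
    simpa [h2] using hS s (by simp)

theorem card_crossPairings_singleton {α : Type*} [Fintype α] {T : Finset α} {s : α}
    (hsT : s ∈ T) : (crossPairings T {s}).card = (crossPairings T ∅).card := by
  congr 1
  ext π
  simp only [mem_crossPairings, Finset.mem_singleton, forall_eq, Finset.notMem_empty,
    not_false_eq_true, implies_true, and_true]
  exact ⟨fun h => ⟨h.1, h.2.1⟩, fun h => ⟨h.1, h.2, (h.2 s).2 hsT⟩⟩

theorem crossPairings_empty {α : Type*} [Fintype α] :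
    crossPairings (∅ : Finset α) ∅ = {id} := by
  ext π
  simp only [mem_crossPairings, Finset.mem_singleton, Finset.notMem_empty, iff_false, not_not,
    not_false_eq_true, implies_true, and_true, funext_iff, id]
  exact ⟨fun h => h.2, fun h => ⟨fun j => by rw [h, h], h⟩⟩

theorem card_crossPairings_mul_succ {α : Type*} [Fintype α] {m k : ℕ}
    (h : ∀ T S : Finset α, S ⊆ T → S.card = k → T.card = 2 * k + 2 * m →
      (crossPairings T S).card * (2 ^ m * m.factorial) = (k + 2 * m).factorial)
    {T S : Finset α} (hST : S ⊆ T) (hS : S.card = k + 1) (hT : T.card = 2 * (k + 1) + 2 * m) :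
    (crossPairings T S).card * (2 ^ m * m.factorial) = (k + 1 + 2 * m).factorial := by
  obtain ⟨s, S, hs, rfl, hk⟩ := Finset.card_eq_succ.1 hS
  have hsT : s ∈ T := hST (by simp)
  rw [card_crossPairings_insert hsT hs, Finset.sum_mul, Finset.sum_congr rfl
    (g := fun _ => (k + 2 * m).factorial), Finset.sum_const, Finset.card_sdiff_of_subset hST,
    hS, hT, smul_eq_mul, show 2 * (k + 1) + 2 * m - (k + 1) = k + 2 * m + 1 by omega,
    ← Nat.factorial_succ, show k + 1 + 2 * m = k + 2 * m + 1 by omega]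
  intro t ht
  simp only [Finset.mem_sdiff, Finset.mem_insert, not_or] at ht
  refine h _ _ (fun x hx => ?_) hk ?_
  · have := hST (Finset.mem_insert_of_mem hx)
    grind
  · have hsub : {s, t} ⊆ T := by
      simp [Finset.insert_subset_iff, hsT, ht.1]
    rw [Finset.card_sdiff_of_subset hsub, Finset.card_pair (Ne.symm ht.2.1), hT]
    omega

theorem card_crossPairings_mul {α : Type*} [Fintype α] (m k : ℕ) (T S : Finset α) (hST : S ⊆ T)
    (hS : S.card = k) (hT : T.card = 2 * k + 2 * m) :
    (crossPairings T S).card * (2 ^ m * m.factorial) = (k + 2 * m).factorial := by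
  induction m generalizing k T S with
  | zero =>
    induction k generalizing T S with
    | zero =>
      obtain rfl := Finset.card_eq_zero.1 hS
      obtain rfl := Finset.card_eq_zero.1 hT
      simp [crossPairings_empty]
    | succ k ih => exact card_crossPairings_mul_succ ih hST hS hT
  | succ m ihm =>
    induction k generalizing T S with
    | zero =>
      obtain rfl := Finset.card_eq_zero.1 hS
      obtain ⟨s, hs⟩ : T.Nonempty := Finset.card_pos.1 (by omega)
      have := ihm 1 T {s} (by simpa using hs) (by simp) (by omega)
      rw [card_crossPairings_singleton hs] at this
      rw [show 0 + 2 * (m + 1) = 1 + 2 * m + 1 by omega, Nat.factorial_succ (1 + 2 * m), ← this,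
        Nat.factorial_succ]
      ring
    | succ k ih => exact card_crossPairings_mul_succ ih hST hS hT

theorem sum_range_choose_div_two_pow_succ (n M : ℕ) :
    ∑ m ∈ Finset.range (M + 1), ((n + 1 + m).choose m : ℚ) / 2 ^ m =
      2 * ∑ m ∈ Finset.range (M + 1), ((n + m).choose m : ℚ) / 2 ^ m -
        ((n + 1 + M).choose M : ℚ) / 2 ^ M := by
  induction M with
  | zero => norm_num
  | succ M ih =>
    rw [Finset.sum_range_succ, ih, Finset.sum_range_succ _ (M + 1),
      show n + 1 + (M + 1) = n + 1 + M + 1 by ring, Nat.choose_succ_succ,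
      show n + (M + 1) = n + 1 + M by ring]
    push_cast
    field_simp
    ring

theorem sum_range_choose_div_two_pow (n : ℕ) :
    ∑ m ∈ Finset.range (n + 1), ((n + m).choose m : ℚ) / 2 ^ m = 2 ^ n := by
  induction n with
  | zero => norm_num
  | succ n ih =>
    have hc : (n + 1 + (n + 1)).choose (n + 1) = 2 * (n + (n + 1)).choose (n + 1) := by
      rw [show n + 1 + (n + 1) = 2 * n + 1 + 1 by ring, show n + (n + 1) = 2 * n + 1 by ring,
        Nat.choose_succ_succ, Nat.choose_symm_half]
      ring
    rw [sum_range_choose_div_two_pow_succ, Finset.sum_range_succ, ih, hc]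
    push_cast
    ring

theorem sum_eq_two_pow_mul_factorial {n : ℕ} {c : ℕ → ℕ}
    (hc : ∀ m ≤ n, c m * (2 ^ m * m.factorial) = (n + m).factorial) :
    ∑ m ∈ Finset.range (n + 1), c m = 2 ^ n * n.factorial := by
  have h : ∀ m ∈ Finset.range (n + 1),
      (c m : ℚ) = ((n + m).choose m : ℚ) / 2 ^ m * n.factorial := by
    intro m hm
    have h1 := hc m (by simpa [Nat.lt_succ_iff] using hm)
    rw [← Nat.add_choose_mul_factorial_mul_factorial n m] at h1
    have h2 : c m * 2 ^ m = (n + m).choose m * n.factorial :=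
      Nat.eq_of_mul_eq_mul_right m.factorial_pos (by linarith)
    rw [div_mul_eq_mul_div, eq_div_iff (by positivity)]
    exact_mod_cast h2
  have := Finset.sum_congr rfl h
  rw [← Finset.sum_mul, sum_range_choose_div_two_pow] at this
  exact_mod_cast this

/-- The first `k` positions of `Fin N`. -/
def initialPositions (N k : ℕ) : Finset (Fin N) :=
  Finset.univ.filter fun j => j.val < k

theorem card_initialPositions {N k : ℕ} (hk : k ≤ N) : (initialPositions N k).card = k := by
  simp [initialPositions, Fin.card_filter_val_lt, hk]

theorem mem_crossPairings_univ_initialPositions {n k : ℕ} {π : Fin (2 * n) → Fin (2 * n)}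
    (hπ : IsDeal n π) :
    π ∈ crossPairings Finset.univ (initialPositions (2 * n) k) ↔
      ∀ j : Fin (2 * n), j.val < k → j < π j := by
  simp only [mem_crossPairings, initialPositions, Finset.mem_filter, Finset.mem_univ, true_and,
    iff_true, not_lt]
  refine ⟨fun h j hj => Fin.lt_def.2 (hj.trans_le (h.2.2 j hj)), fun h => ⟨fun j => (hπ j).1,
    fun j => (hπ j).2, fun j hj => ?_⟩⟩
  by_contra! hlt
  have h1 := h j hj
  have h2 := h (π j) hlt
  rw [(hπ j).1] at h2
  exact lt_asymm h1 h2

theorem crossPairings_subset_deals {n : ℕ} {S : Finset (Fin (2 * n))} :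
    crossPairings Finset.univ S ⊆ deals n := by
  intro π hπ
  obtain ⟨hinv, hsupp, -⟩ := mem_crossPairings.1 hπ
  simp only [deals, Finset.mem_filter, Finset.mem_univ, true_and]
  exact fun j => ⟨hinv j, (hsupp j).2 (Finset.mem_univ j)⟩

theorem exists_apply_lt_of_isDeal {n : ℕ} (hn : 1 ≤ n) {π : Fin (2 * n) → Fin (2 * n)}
    (hπ : IsDeal n π) : ∃ j ≤ n, ∃ h : j < 2 * n, (π ⟨j, h⟩).val < j := by
  by_contra! hno
  have hmem : π ∈ crossPairings Finset.univ (initialPositions (2 * n) (n + 1)) := by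
    rw [mem_crossPairings_univ_initialPositions hπ]
    intro j hj
    exact lt_of_le_of_ne (hno j (Nat.lt_succ_iff.1 hj) j.2) (hπ j).2.symm
  have hS := (mem_crossPairings.1 hmem).2.2
  have hle := Finset.card_le_card_of_injOn (s := initialPositions (2 * n) (n + 1))
    (t := Finset.univ \ initialPositions (2 * n) (n + 1)) π
    (fun j hj => by simpa using hS j hj)
    (fun a _ b _ hab => by rw [← (hπ a).1, hab, (hπ b).1])
  rw [Finset.card_sdiff_of_subset (Finset.subset_univ _), card_initialPositions (by omega),
    Finset.card_univ, Fintype.card_fin] at hle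
  omega

theorem firstMatch_eq_card {n : ℕ} (hn : 1 ≤ n) {π : Fin (2 * n) → Fin (2 * n)}
    (hπ : IsDeal n π) :
    firstMatch π = ((Finset.range (n + 1)).filter fun k =>
      π ∈ crossPairings Finset.univ (initialPositions (2 * n) k)).card := by
  obtain ⟨i, hin, hi⟩ := exists_apply_lt_of_isDeal hn hπ
  set A := {j : ℕ | ∃ h : j < 2 * n, (π ⟨j, h⟩).val < j} with hA
  have hiA : i ∈ A := hi
  have hmem : sInf A ∈ A := Nat.sInf_mem ⟨i, hiA⟩
  have hle : sInf A ≤ n := (Nat.sInf_le hiA).trans hin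
  have : ((Finset.range (n + 1)).filter fun k =>
      π ∈ crossPairings Finset.univ (initialPositions (2 * n) k)) =
      Finset.range (1 + sInf A) := by
    ext k
    simp only [Finset.mem_filter, Finset.mem_range, mem_crossPairings_univ_initialPositions hπ]
    constructor
    · rintro ⟨-, h⟩
      by_contra! hlt
      obtain ⟨h1, h2⟩ := hmem
      exact lt_asymm h2 (h ⟨sInf A, h1⟩ (by simp; omega))
    · intro hk
      refine ⟨by omega, fun j hj => lt_of_le_of_ne ?_ (hπ j).2.symm⟩
      by_contra! hlt
      have : sInf A ≤ j := Nat.sInf_le ⟨j.2, hlt⟩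
      omega
  rw [this, Finset.card_range]
  rfl

/-- The sum of `f(π)` over all deals `π ∈ D_n` equals `2^n * n!`. -/
theorem sum_firstMatch (n : ℕ) (hn : 1 ≤ n) :
    ∑ π ∈ deals n, firstMatch π = 2^n * Nat.factorial n := by
  have h1 : ∀ π ∈ deals n, firstMatch π = ∑ k ∈ Finset.range (n + 1),
      if π ∈ crossPairings Finset.univ (initialPositions (2 * n) k) then 1 else 0 := by
    intro π hπ
    rw [firstMatch_eq_card hn (by simpa [deals] using hπ), Finset.card_filter]
  rw [Finset.sum_congr rfl h1, Finset.sum_comm, ← Finset.sum_range_reflect]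
  refine sum_eq_two_pow_mul_factorial fun m hm => ?_
  rw [← Finset.card_filter, Finset.filter_mem_eq_inter,
    Finset.inter_eq_right.2 crossPairings_subset_deals,
    card_crossPairings_mul m (n - m) _ _ (Finset.subset_univ _)]
  · congr 1
    omega
  · rw [card_initialPositions (by omega)]
    omega
  · rw [Finset.card_univ, Fintype.card_fin]
    omega
end

section
/- Let E_n = 3n/2 + (1/(2·|D_n|))·∑_{π ∈ D_n} e(π) − (1/|D_n|)·∑_{π ∈ D_n} l(π) (a real number; E_n is the expected length of an optimally played solitaire memory game with n pairs). Then lim_{n → ∞} ( E_n − ( (3 − 2·ln 2)·n + 7/8 − 2·ln 2 ) ) = 0. -/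
open scoped Classical

/-- The second occurrences of `π` (positions `j` with `π j < j`), in
increasing order: `j_1 < j_2 < ... < j_n`. -/
def blockEnds {n : ℕ} (π : Fin (2*n) → Fin (2*n)) : List (Fin (2*n)) :=
  (Finset.univ.filter (fun j => π j < j)).sort (· ≤ ·)

/-- The block lengths `b_1, ..., b_n` of a deal:
`b_1 = j_1 + 1` and `b_i = j_i - j_(i-1)` for `i ≥ 2`. -/
def blockLens {n : ℕ} (π : Fin (2*n) → Fin (2*n)) : List ℕ :=
  List.zipWith (fun x y => x - y)
    ((blockEnds π).map (fun j => (j : ℕ) + 1))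
    (0 :: (blockEnds π).map (fun j => (j : ℕ) + 1))

/-- The blocks of a deal: each block length `b_i` paired with the ending
position `j_i` of the block. -/
def blocks {n : ℕ} (π : Fin (2*n) → Fin (2*n)) : List (ℕ × Fin (2*n)) :=
  List.zip (blockLens π) (blockEnds π)

/-- The `i`-th block (ending at position `j_i`) is lucky if `π j_i = j_i - 1`. -/
def IsLuckyEnd {n : ℕ} (π : Fin (2*n) → Fin (2*n)) (j : Fin (2*n)) : Prop :=
  (π j).val = (j : ℕ) - 1

/-- `b(n,j)`: total number of blocks of length `j` over all deals in `D_n`. -/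
noncomputable def bcount (n j : ℕ) : ℕ :=
  ∑ π ∈ deals n, (blockLens π).count j

/-- `l(n,j)`: total number of lucky blocks of length `j` over all deals in `D_n`. -/
noncomputable def lcount (n j : ℕ) : ℕ :=
  ∑ π ∈ deals n, (blocks π).countP (fun p => decide (p.1 = j ∧ IsLuckyEnd π p.2))

/-- `eb(n,j)`: the expected number of blocks of length `j` in a random deal. -/
noncomputable def eb (n j : ℕ) : ℝ := (bcount n j : ℝ) / ((deals n).card : ℝ)

/-- `el(n,j)`: the expected number of lucky blocks of length `j` in a random deal. -/
noncomputable def el (n j : ℕ) : ℝ := (lcount n j : ℝ) / ((deals n).card : ℝ)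

/-- `db(n,j) = eb(n,j) - 2(2n+1)/(j(j+1)(j+2))`. -/
noncomputable def db (n j : ℕ) : ℝ :=
  eb n j - 2*(2*(n:ℝ)+1) / ((j:ℝ) * ((j:ℝ)+1) * ((j:ℝ)+2))

/-- `dl(n,j) = el(n,j) - 1/(j(j-1))`. -/
noncomputable def dl (n j : ℕ) : ℝ :=
  el n j - 1 / ((j:ℝ) * ((j:ℝ)-1))

/-- `e(π)`: the number of blocks of `π` of even length. -/
noncomputable def evenBlocks {n : ℕ} (π : Fin (2*n) → Fin (2*n)) : ℕ :=
  (blockLens π).countP (fun b => decide (Even b))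

/-- `l(π)`: the number of even-length lucky blocks of `π`. -/
noncomputable def luckyEvenBlocks {n : ℕ} (π : Fin (2*n) → Fin (2*n)) : ℕ :=
  (blocks π).countP (fun p => decide (Even p.1 ∧ IsLuckyEnd π p.2))

open Filter

/-- The number of perfect matchings of `2 * q` points. -/
def numPairings (q : ℕ) : ℕ := ∏ i ∈ Finset.range q, (2 * i + 1)

/-- The involutions of `ι` moving exactly the points of `s` and mapping `W` into `R`. -/
noncomputable def pairings {ι : Type*} [Fintype ι] (s W R : Finset ι) : Finset (ι → ι) :=
  Finset.univ.filter fun f =>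
    (∀ x, f (f x) = x) ∧ (∀ x, f x ≠ x ↔ x ∈ s) ∧ ∀ w ∈ W, f w ∈ R

theorem mem_pairings {ι : Type*} [Fintype ι] {s W R : Finset ι} {f : ι → ι} :
    f ∈ pairings s W R ↔
      (∀ x, f (f x) = x) ∧ (∀ x, f x ≠ x ↔ x ∈ s) ∧ ∀ w ∈ W, f w ∈ R := by
  simp [pairings]

theorem card_pairings_filter_apply_eq {ι : Type*} [Fintype ι] [DecidableEq ι]
    {s W R : Finset ι} {a b : ι} (hab : a ≠ b) (ha : a ∈ s) (hb : b ∈ s)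
    (haW : a ∉ W) (hbW : b ∉ W) :
    ((pairings s W R).filter fun f => f a = b).card
      = (pairings (s \ {a, b}) W (R \ {a, b})).card := by
  refine Finset.card_bij' (fun f _ x => if x = a then a else if x = b then b else f x)
    (fun g _ x => if x = a then b else if x = b then a else g x) ?_ ?_ ?_ ?_
  · intro f hf
    simp only [Finset.mem_filter, mem_pairings] at hf
    obtain ⟨⟨h1, h2, h3⟩, h4⟩ := hf
    have h5 : f b = a := by rw [← h4, h1]
    have hfa : ∀ x, f x = a → x = b := fun x hx => by rw [← h1 x, hx, h4]
    have hfb : ∀ x, f x = b → x = a := fun x hx => by rw [← h1 x, hx, h5]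
    simp only [mem_pairings, Finset.mem_sdiff, Finset.mem_insert, Finset.mem_singleton]
    refine ⟨fun x => ?_, fun x => ?_, fun w hw => ?_⟩
    · grind
    · grind
    · grind
  · intro g hg
    simp only [mem_pairings, Finset.mem_sdiff, Finset.mem_insert, Finset.mem_singleton] at hg
    obtain ⟨h1, h2, h3⟩ := hg
    have hga : g a = a := by grind
    have hgb : g b = b := by grind
    have hfa : ∀ x, g x = a → x = a := fun x hx => by rw [← h1 x, hx, hga]
    have hfb : ∀ x, g x = b → x = b := fun x hx => by rw [← h1 x, hx, hgb]
    simp only [Finset.mem_filter, mem_pairings]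
    refine ⟨⟨fun x => ?_, fun x => ?_, fun w hw => ?_⟩, ?_⟩
    · grind
    · grind
    · grind
    · grind
  · intro f hf
    simp only [Finset.mem_filter, mem_pairings] at hf
    obtain ⟨⟨h1, h2, h3⟩, h4⟩ := hf
    funext x
    grind
  · intro g hg
    simp only [mem_pairings, Finset.mem_sdiff, Finset.mem_insert, Finset.mem_singleton] at hg
    obtain ⟨h1, h2, h3⟩ := hg
    funext x
    grind

theorem card_pairings_insert {ι : Type*} [Fintype ι] [DecidableEq ι]
    {s W R : Finset ι} {w : ι} (hw : w ∉ W) (hws : w ∈ s) (hR : R ⊆ s) (hwR : w ∉ R)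
    (hWR : Disjoint W R) :
    (pairings s (insert w W) R).card = ∑ r ∈ R, (pairings (s \ {w, r}) W (R \ {w, r})).card := by
  rw [Finset.card_eq_sum_card_fiberwise (f := fun f => f w) (t := R)]
  · refine Finset.sum_congr rfl fun r hr => ?_
    rw [← card_pairings_filter_apply_eq (R := R) (by grind) hws (hR hr) hw
      (Finset.disjoint_right.1 hWR hr)]
    congr 1
    ext f
    simp only [Finset.mem_filter, mem_pairings, Finset.mem_insert, forall_eq_or_imp]
    grind
  · intro f hf
    exact (mem_pairings.1 hf).2.2 w (Finset.mem_insert_self w W)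

theorem card_pairings_empty {ι : Type*} [Fintype ι] [DecidableEq ι] (q : ℕ) :
    ∀ s R : Finset ι, s.card = 2 * q → (pairings s ∅ R).card = numPairings q := by
  induction q with
  | zero =>
    intro s R hs
    obtain rfl : s = ∅ := by simpa using hs
    rw [numPairings, Finset.prod_range_zero, Finset.card_eq_one]
    refine ⟨id, ?_⟩
    ext f
    simp only [mem_pairings, Finset.mem_singleton, Finset.notMem_empty, iff_false, not_not]
    constructor
    · rintro ⟨-, h, -⟩
      exact funext h
    · rintro rfl
      simp
  | succ q ih =>
    intro s R hs
    obtain ⟨w, hw⟩ : s.Nonempty := Finset.card_pos.1 (by omega)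
    have h : pairings s ∅ R = pairings s (insert w ∅) (s.erase w) := by
      ext f
      simp only [mem_pairings, Finset.mem_insert, Finset.mem_erase]
      grind
    rw [h, card_pairings_insert (by simp) hw (Finset.erase_subset _ _) (by simp) (by simp),
      Finset.sum_congr rfl (g := fun _ => numPairings q), Finset.sum_const,
      Finset.card_erase_of_mem hw, hs, numPairings, numPairings, Finset.prod_range_succ]
    · rw [smul_eq_mul, mul_comm]
      rfl
    · intro r hr
      rw [Finset.mem_erase] at hr
      refine ih _ _ ?_
      rw [Finset.card_sdiff_of_subset (by grind), Finset.card_pair hr.1.symm]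
      omega

theorem card_pairings {ι : Type*} [Fintype ι] [DecidableEq ι] (W : Finset ι) :
    ∀ (q : ℕ) (s R : Finset ι), s.card = 2 * q → W ⊆ s → R ⊆ s → Disjoint W R →
      (pairings s W R).card = R.card.descFactorial W.card * numPairings (q - W.card) := by
  induction W using Finset.induction_on with
  | empty =>
    intro q s R hs _ _ _
    simp [card_pairings_empty q s R hs]
  | insert w W hw ih =>
    intro q s R hs hW hR hWR
    rw [Finset.disjoint_insert_left] at hWR
    rw [card_pairings_insert hw (hW (Finset.mem_insert_self w W)) hR hWR.1 hWR.2,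
      Finset.sum_congr rfl (g := fun _ => (R.card - 1).descFactorial W.card *
        numPairings (q - (W.card + 1))), Finset.sum_const, Finset.card_insert_of_notMem hw]
    · rcases hm : R.card with _ | m
      · simp
      · rw [Nat.succ_descFactorial_succ, smul_eq_mul, mul_assoc, Nat.add_sub_cancel]
    · intro r hr
      have hwr : w ≠ r := by grind
      have hws : w ∈ s := hW (Finset.mem_insert_self w W)
      have h1 : (s \ {w, r}).card = 2 * (q - 1) := by
        rw [Finset.card_sdiff_of_subset (by grind), Finset.card_pair hwr]
        omega
      have h2 : (R \ {w, r}).card = R.card - 1 := by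
        rw [show R \ {w, r} = R.erase r by grind, Finset.card_erase_of_mem hr]
      have hrW : r ∉ W := Finset.disjoint_right.1 hWR.2 hr
      rw [ih (q - 1) _ _ h1 (by grind) (by grind)
        (hWR.2.mono_right Finset.sdiff_subset), h2, Nat.sub_sub, add_comm 1]

theorem card_fin_filter_Ico {N a b : ℕ} (hb : b ≤ N) :
    (Finset.univ.filter fun x : Fin N => a ≤ x.val ∧ x.val < b).card = b - a := by
  rw [← Nat.card_Ico, ← Finset.card_map Fin.valEmbedding]
  congr 1
  ext x
  simp only [Finset.mem_map, Finset.mem_filter, Finset.mem_univ, true_and,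
    Fin.valEmbedding_apply, Finset.mem_Ico]
  exact ⟨by rintro ⟨y, hy, rfl⟩; exact hy, fun hx => ⟨⟨x, by omega⟩, hx, rfl⟩⟩

theorem mem_deals {n : ℕ} {π : Fin (2*n) → Fin (2*n)} :
    π ∈ deals n ↔ ∀ j, π (π j) = j ∧ π j ≠ j := by
  simp [deals, IsDeal]

theorem deals_eq_pairings (n : ℕ) : deals n = pairings Finset.univ ∅ ∅ := by
  ext π
  simp [mem_deals, mem_pairings, forall_and]

theorem card_deals (n : ℕ) : (deals n).card = numPairings n := by
  rw [deals_eq_pairings]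
  exact card_pairings_empty n _ _ (by simp)

/-- The positions `a, ..., a + k - 1` are all first occurrences of `π`. -/
def FirstOn {n : ℕ} (π : Fin (2*n) → Fin (2*n)) (a k : ℕ) : Prop :=
  ∀ x : Fin (2*n), a ≤ x.val → x.val < a + k → x < π x

theorem firstOn_iff_mem_pairings {n : ℕ} {π : Fin (2*n) → Fin (2*n)} {a k : ℕ} :
    π ∈ deals n ∧ FirstOn π a k ↔
      π ∈ pairings Finset.univ (Finset.univ.filter fun x => a ≤ x.val ∧ x.val < a + k)
        (Finset.univ.filter fun x => a + k ≤ x.val ∧ x.val < 2 * n) := by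
  rw [mem_deals, mem_pairings, forall_and, and_assoc]
  simp only [Finset.mem_univ, iff_true, Finset.mem_filter, true_and, FirstOn]
  refine and_congr_right fun h1 => and_congr_right fun h2 => ?_
  constructor
  · intro h x hx
    have hlt := h x hx.1 hx.2
    refine ⟨?_, (π x).isLt⟩
    by_contra hc
    have h3 := h (π x) (by rw [Fin.lt_def] at hlt; omega) (by omega)
    rw [h1] at h3
    exact lt_asymm hlt h3
  · intro h x hx hx'
    rw [Fin.lt_def]
    have := (h x ⟨hx, hx'⟩).1
    omega

theorem card_firstOn {n a k m : ℕ} (h : a + k + m = 2 * n) :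
    ((deals n).filter fun π => FirstOn π a k).card
      = m.descFactorial k * numPairings (n - k) := by
  have : ((deals n).filter fun π => FirstOn π a k) = _ :=
    Finset.ext fun π => Finset.mem_filter.trans firstOn_iff_mem_pairings
  rw [this, card_pairings _ n _ _ (by simp) (Finset.subset_univ _) (Finset.subset_univ _),
    card_fin_filter_Ico le_rfl, card_fin_filter_Ico (by omega)]
  · congr 2
    · omega
    · omega
    · omega
  · rw [Finset.disjoint_filter]
    intros
    omega

theorem card_lucky_firstOn {n a k m : ℕ} (h : a + k + m + 2 = 2 * n) {j : Fin (2*n)}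
    (hj : j.val = a + k + 1) :
    ((deals n).filter fun π => π j < j ∧ IsLuckyEnd π j ∧ FirstOn π a (k + 1)).card
      = m.descFactorial k * numPairings (n - 1 - k) := by
  have hi : a + k < 2 * n := by omega
  obtain ⟨i, rfl⟩ : ∃ i, i = (⟨a + k, hi⟩ : Fin (2*n)) := ⟨_, rfl⟩
  set i : Fin (2*n) := ⟨a + k, hi⟩ with hidef
  have hij : i ≠ j := by
    rw [Ne, Fin.ext_iff, hj]
    simp [hidef]
  set W : Finset (Fin (2*n)) := Finset.univ.filter fun x => a ≤ x.val ∧ x.val < a + k with hW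
  set R : Finset (Fin (2*n)) :=
    Finset.univ.filter fun x => a + k ≤ x.val ∧ x.val < 2 * n with hR
  have key : ((deals n).filter fun π => π j < j ∧ IsLuckyEnd π j ∧ FirstOn π a (k + 1))
      = (pairings Finset.univ W R).filter fun π => π i = j := by
    ext π
    rw [Finset.mem_filter, Finset.mem_filter, ← firstOn_iff_mem_pairings, and_assoc]
    refine and_congr_right fun hπ => ?_
    rw [mem_deals] at hπ
    constructor
    · rintro ⟨-, h2, h3⟩
      refine ⟨fun x hx hx' => h3 x hx (by omega), ?_⟩
      have : π j = i := by
        rw [Fin.ext_iff, h2, hj]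
        simp [hidef]
      rw [← this, (hπ j).1]
    · rintro ⟨h1, h2⟩
      have h3 : π j = i := by rw [← h2, (hπ i).1]
      have hlt : i < j := by rw [Fin.lt_def, hj]; simp [hidef]
      refine ⟨by rwa [h3], by rw [IsLuckyEnd, h3, hj]; simp [hidef], fun x hx hx' => ?_⟩
      rcases Nat.lt_or_ge x.val (a + k) with hlt' | hge
      · exact h1 x hx hlt'
      · obtain rfl : x = i := Fin.ext (by simp only [hidef]; omega)
        rwa [h2]
  have hR' : R \ {i, j} = Finset.univ.filter fun x => a + k + 2 ≤ x.val ∧ x.val < 2 * n := by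
    ext x
    simp only [hR, Finset.mem_sdiff, Finset.mem_filter, Finset.mem_univ, true_and,
      Finset.mem_insert, Finset.mem_singleton, Fin.ext_iff, hj, hidef]
    omega
  have hWi : i ∉ W := by simp [hW, hidef]
  have hWj : j ∉ W := by simp [hW, hj]
  rw [key, card_pairings_filter_apply_eq hij (Finset.mem_univ _) (Finset.mem_univ _) hWi hWj,
    hR', card_pairings _ (n - 1), hW, card_fin_filter_Ico le_rfl, card_fin_filter_Ico (by omega)]
  · congr 2
    · omega
    · omega
    · omega
  · rw [Finset.card_sdiff_of_subset (Finset.subset_univ _), Finset.card_pair hij,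
      Finset.card_univ, Fintype.card_fin]
    omega
  · intro x hx
    simp only [Finset.mem_sdiff, Finset.mem_univ, true_and, Finset.mem_insert,
      Finset.mem_singleton]
    rintro (rfl | rfl)
    · exact hWi hx
    · exact hWj hx
  · rw [← hR']
    exact Finset.sdiff_subset_sdiff (Finset.subset_univ _) subset_rfl
  · rw [Finset.disjoint_filter]
    intros
    omega

/-- The length of the block of `π` ending at position `j`. -/
noncomputable def blockLen {n : ℕ} (π : Fin (2*n) → Fin (2*n)) (j : Fin (2*n)) : ℕ :=
  j.val + 1 - (Finset.univ.filter fun x => π x < x ∧ x < j).sup fun x => x.val + 1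

theorem le_blockLen_iff {n : ℕ} {π : Fin (2*n) → Fin (2*n)} {j : Fin (2*n)} {c : ℕ}
    (hc : 1 ≤ c) :
    c ≤ blockLen π j ↔
      c ≤ j.val + 1 ∧ ∀ x : Fin (2*n), π x < x → x < j → x.val + c ≤ j.val := by
  have h : c ≤ blockLen π j ↔ c ≤ j.val + 1 ∧
      ((Finset.univ.filter fun x => π x < x ∧ x < j).sup fun x => x.val + 1)
        ≤ j.val + 1 - c := by
    rw [blockLen]
    omega
  rw [h, Finset.sup_le_iff]
  refine and_congr_right fun hcj => forall_congr' fun x => ?_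
  simp only [Finset.mem_filter, Finset.mem_univ, true_and, and_imp, Fin.lt_def]
  constructor
  · intro h h1 h2
    have := h h1 h2
    omega
  · intro h h1 h2
    have := h h1 h2
    omega

theorem zipWith_sub_map_eq {N : ℕ} (φ : Fin N → ℕ) (l : List (Fin N)) :
    ∀ p : ℕ, l.Pairwise (· < ·) → (∀ x ∈ l, p ≤ x.val) →
      (∀ j ∈ l, (∀ x ∈ l, x < j → x.val + φ j ≤ j.val) ∧ p + φ j ≤ j.val + 1 ∧
        (p + φ j = j.val + 1 ∨ ∃ x ∈ l, x < j ∧ x.val + φ j = j.val)) →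
      List.zipWith (fun x y => x - y) (l.map fun j => j.val + 1) (p :: l.map fun j => j.val + 1)
        = l.map φ := by
  induction l with
  | nil => simp
  | cons i l ih =>
    intro p hs hp hφ
    rw [List.pairwise_cons] at hs
    have hi := hφ i List.mem_cons_self
    have hpi := hp i List.mem_cons_self
    rw [List.map_cons, List.zipWith_cons_cons, List.map_cons, ih (i.val + 1) hs.2]
    · congr 1
      rcases hi.2.2 with h | ⟨x, hx, hxi, -⟩
      · omega
      · rcases List.mem_cons.1 hx with rfl | hx
        · exact absurd hxi (lt_irrefl _)
        · exact absurd hxi (lt_asymm (hs.1 x hx))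
    · exact fun x hx => hs.1 x hx
    · intro j hj
      have hij := hs.1 j hj
      obtain ⟨h1, h2, h3⟩ := hφ j (List.mem_cons_of_mem _ hj)
      have h4 := h1 i List.mem_cons_self hij
      refine ⟨fun x hx => h1 x (List.mem_cons_of_mem _ hx), by omega, ?_⟩
      rcases h3 with h3 | ⟨x, hx, hxj, hx'⟩
      · omega
      · rcases List.mem_cons.1 hx with rfl | hx
        · left
          omega
        · exact Or.inr ⟨x, hx, hxj, hx'⟩

theorem mem_blockEnds {n : ℕ} {π : Fin (2*n) → Fin (2*n)} {j : Fin (2*n)} :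
    j ∈ blockEnds π ↔ π j < j := by
  simp [blockEnds]

theorem blockLens_eq_map {n : ℕ} (π : Fin (2*n) → Fin (2*n)) :
    blockLens π = (blockEnds π).map (blockLen π) := by
  have hmap : blockLens π = List.zipWith (fun x y => x - y)
      ((blockEnds π).map fun j : Fin (2*n) => j.val + 1)
      (0 :: (blockEnds π).map fun j : Fin (2*n) => j.val + 1) := by
    simp [blockLens, ← List.map_eq_flatMap, Function.comp_def]
  rw [hmap]
  refine zipWith_sub_map_eq (blockLen π) (blockEnds π) 0 (Finset.sortedLT_sort _).pairwise
    (by simp) fun j hj => ⟨fun x hx hxj => ?_, ?_, ?_⟩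
  · rw [mem_blockEnds] at hx
    have hmem : x ∈ Finset.univ.filter fun x => π x < x ∧ x < j := by
      simp [hx, hxj]
    have := Finset.le_sup (f := fun x : Fin (2*n) => x.val + 1) hmem
    rw [Fin.lt_def] at hxj
    rw [blockLen]
    omega
  · rw [blockLen]
    omega
  · rcases (Finset.univ.filter fun x => π x < x ∧ x < j).eq_empty_or_nonempty with h | h
    · left
      simp [blockLen, h]
    · right
      obtain ⟨x, hx, hsup⟩ := Finset.exists_mem_eq_sup _ h fun x => x.val + 1
      simp only [Finset.mem_filter, Finset.mem_univ, true_and] at hx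
      refine ⟨x, mem_blockEnds.2 hx.1, hx.2, ?_⟩
      have := hx.2
      rw [Fin.lt_def] at this
      rw [blockLen, hsup]
      omega

theorem countP_blockEnds {n : ℕ} (π : Fin (2*n) → Fin (2*n)) (p : Fin (2*n) → Bool) :
    (blockEnds π).countP p = (Finset.univ.filter fun j => π j < j ∧ p j = true).card := by
  have hnd : ((blockEnds π).filter p).Nodup := (Finset.sort_nodup _ _).filter p
  rw [List.countP_eq_length_filter, ← List.toFinset_card_of_nodup hnd]
  congr 1
  ext j
  simp [mem_blockEnds]

theorem evenBlocks_eq_card {n : ℕ} (π : Fin (2*n) → Fin (2*n)) :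
    evenBlocks π = (Finset.univ.filter fun j => π j < j ∧ Even (blockLen π j)).card := by
  rw [evenBlocks, blockLens_eq_map, List.countP_map, countP_blockEnds]
  simp

theorem luckyEvenBlocks_eq_card {n : ℕ} (π : Fin (2*n) → Fin (2*n)) :
    luckyEvenBlocks π = (Finset.univ.filter fun j =>
      π j < j ∧ IsLuckyEnd π j ∧ Even (blockLen π j)).card := by
  have : blocks π = (blockEnds π).map fun j => (blockLen π j, j) := by
    rw [blocks, blockLens_eq_map, List.map_prod_right_eq_zip]
  rw [luckyEvenBlocks, this, List.countP_map, countP_blockEnds]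
  simp [and_comm]

theorem sum_neg_one_pow_ite {b M : ℕ} (h1 : 1 ≤ b) (hM : b ≤ M + 1) :
    ∑ k ∈ Finset.range M, (-1 : ℝ) ^ k * (if k + 2 ≤ b then 1 else 0)
      = if Even b then 1 else 0 := by
  simp only [mul_ite, mul_one, mul_zero]
  rw [← Finset.sum_filter,
    show (Finset.range M).filter (fun k => k + 2 ≤ b) = Finset.range (b - 1) by
      ext k
      simp only [Finset.mem_filter, Finset.mem_range]
      omega,
    neg_one_geom_sum]
  obtain ⟨b, rfl⟩ : ∃ c, b = c + 1 := ⟨b - 1, by omega⟩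
  simp [Nat.even_add_one, -Nat.not_even_iff_odd]

theorem le_blockLen_iff_firstOn {n a k : ℕ} {π : Fin (2*n) → Fin (2*n)} (hπ : π ∈ deals n)
    {j : Fin (2*n)} (hj : j.val = k + 1 + a) :
    k + 2 ≤ blockLen π j ↔ FirstOn π a (k + 1) := by
  rw [mem_deals] at hπ
  rw [le_blockLen_iff (by omega), FirstOn]
  constructor
  · rintro ⟨-, h⟩ x hx hx'
    refine lt_of_le_of_ne (not_lt.1 fun hlt => ?_) (hπ x).2.symm
    have := h x hlt (by rw [Fin.lt_def]; omega)
    omega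
  · refine fun h => ⟨by omega, fun x hx hxj => ?_⟩
    rw [Fin.lt_def] at hxj
    by_contra hc
    exact lt_asymm hx (h x (by omega) (by omega))

theorem sum_card_even_blockLen {n : ℕ} (hn : 1 ≤ n)
    (Q : (Fin (2*n) → Fin (2*n)) → Fin (2*n) → Prop) :
    ∑ π ∈ deals n,
      ((Finset.univ.filter fun j => π j < j ∧ Q π j ∧ Even (blockLen π j)).card : ℝ)
      = ∑ k ∈ Finset.range (2 * n - 1), (-1 : ℝ) ^ k * ∑ a ∈ Finset.range (2 * n - 1 - k),
        (((deals n).filter fun π => ∃ j : Fin (2*n), j.val = k + 1 + a ∧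
          π j < j ∧ Q π j ∧ FirstOn π a (k + 1)).card : ℝ) := by
  have hone : ∀ (π : Fin (2*n) → Fin (2*n)) (j : Fin (2*n)),
      (if π j < j ∧ Q π j ∧ Even (blockLen π j) then (1 : ℝ) else 0)
        = ∑ k ∈ Finset.range (2 * n - 1), (-1 : ℝ) ^ k *
          (if π j < j ∧ Q π j ∧ k + 2 ≤ blockLen π j then 1 else 0) := by
    intro π j
    by_cases hQ : π j < j ∧ Q π j
    · have h1 : 1 ≤ blockLen π j := by
        rw [le_blockLen_iff le_rfl]
        refine ⟨by omega, fun x _ hx => ?_⟩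
        rw [Fin.lt_def] at hx
        omega
      have h2 : blockLen π j ≤ 2 * n - 1 + 1 := by
        have : blockLen π j ≤ j.val + 1 := Nat.sub_le _ _
        omega
      simp only [hQ.1, hQ.2, true_and]
      exact (sum_neg_one_pow_ite h1 h2).symm
    · simp only [← and_assoc, hQ, false_and, if_false, mul_zero, Finset.sum_const_zero]
  simp only [Finset.card_filter, Nat.cast_sum, Nat.cast_ite, Nat.cast_one, Nat.cast_zero, hone]
  have hswap : ∀ π ∈ deals n, ∑ j, ∑ k ∈ Finset.range (2 * n - 1), (-1 : ℝ) ^ k *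
        (if π j < j ∧ Q π j ∧ k + 2 ≤ blockLen π j then 1 else 0)
      = ∑ k ∈ Finset.range (2 * n - 1), (-1 : ℝ) ^ k * ∑ j,
        (if π j < j ∧ Q π j ∧ k + 2 ≤ blockLen π j then 1 else 0) := by
    intro π _
    rw [Finset.sum_comm]
    simp only [Finset.mul_sum]
  rw [Finset.sum_congr rfl hswap, Finset.sum_comm]
  refine Finset.sum_congr rfl fun k hk => ?_
  rw [Finset.mem_range] at hk
  rw [← Finset.mul_sum, Finset.sum_comm (t := deals n)]
  congr 1
  refine Finset.sum_congr rfl fun π hπ => ?_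
  set G : ℕ → ℝ := fun i => if ∃ j : Fin (2*n), j.val = i ∧ π j < j ∧ Q π j ∧
    k + 2 ≤ blockLen π j then 1 else 0 with hG
  have hGj : ∀ j : Fin (2*n),
      (if π j < j ∧ Q π j ∧ k + 2 ≤ blockLen π j then (1 : ℝ) else 0) = G j.val := by
    intro j
    simp only [hG]
    congr 1
    rw [eq_iff_iff]
    constructor
    · exact fun h => ⟨j, rfl, h⟩
    · rintro ⟨i, hi, h⟩
      rwa [← Fin.ext hi]
  simp only [hGj]
  rw [Fin.sum_univ_eq_sum_range G (2 * n),
    show Finset.range (2 * n) = Finset.range ((k + 1) + (2 * n - 1 - k)) by congr 1; omega,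
    Finset.sum_range_add, Finset.sum_eq_zero, zero_add]
  · refine Finset.sum_congr rfl fun a _ => ?_
    simp only [hG]
    congr 1
    rw [eq_iff_iff]
    refine exists_congr fun j => and_congr_right fun hj => ?_
    rw [le_blockLen_iff_firstOn hπ hj]
  · intro i hi
    rw [Finset.mem_range] at hi
    refine if_neg ?_
    rintro ⟨j, hj, -, -, h⟩
    have : blockLen π j ≤ j.val + 1 := Nat.sub_le _ _
    omega

/-- The number of pairs of a deal of size `n` and a window of `k` consecutive first occurrences. -/
noncomputable def windowCount (n k : ℕ) : ℝ :=
  ∑ a ∈ Finset.range (2 * n + 1 - k),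
    (((2 * n - k - a).descFactorial k * numPairings (n - k) : ℕ) : ℝ)

/-- The alternating sum over `k` of the window counts. -/
noncomputable def altWindowCount (n : ℕ) : ℝ :=
  ∑ k ∈ Finset.range (2 * n + 1), (-1 : ℝ) ^ k * windowCount n k

theorem sum_luckyEvenBlocks (n : ℕ) :
    ∑ π ∈ deals (n + 1), (luckyEvenBlocks π : ℝ) = altWindowCount n := by
  simp only [luckyEvenBlocks_eq_card]
  rw [sum_card_even_blockLen (by omega), altWindowCount,
    show 2 * (n + 1) - 1 = 2 * n + 1 by omega]
  refine Finset.sum_congr rfl fun k hk => ?_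
  rw [Finset.mem_range] at hk
  rw [windowCount]
  congr 1
  refine Finset.sum_congr rfl fun a ha => ?_
  rw [Finset.mem_range] at ha
  have hlt : k + 1 + a < 2 * (n + 1) := by omega
  have := card_lucky_firstOn (n := n + 1) (a := a) (k := k) (m := 2 * n - k - a) (by omega)
    (j := ⟨k + 1 + a, hlt⟩) (by simp only; omega)
  rw [Nat.add_sub_cancel] at this
  rw [← this]
  congr 2
  ext π
  simp only [Finset.mem_filter]
  refine and_congr_right fun _ => ?_
  constructor
  · rintro ⟨j, hj, h⟩
    obtain rfl : j = ⟨k + 1 + a, hlt⟩ := Fin.ext hj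
    exact h
  · exact fun h => ⟨_, rfl, h⟩

theorem card_second_firstOn {n a k : ℕ} (h : k + 1 + a < 2 * n) :
    (((deals n).filter fun π => ∃ j : Fin (2*n), j.val = k + 1 + a ∧
          π j < j ∧ True ∧ FirstOn π a (k + 1)).card : ℝ)
      = (((2 * n - (k + 1) - a).descFactorial (k + 1) * numPairings (n - (k + 1)) : ℕ) : ℝ)
        - (((2 * n - (k + 2) - a).descFactorial (k + 2) * numPairings (n - (k + 2)) : ℕ) : ℝ) := by
  rw [← card_firstOn (a := a) (by omega), ← card_firstOn (a := a) (by omega), eq_sub_iff_add_eq]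
  norm_cast
  rw [← Finset.card_union_of_disjoint]
  · congr 1
    ext π
    simp only [Finset.mem_union, Finset.mem_filter, ← and_or_left]
    refine and_congr_right fun hπ => ?_
    rw [mem_deals] at hπ
    constructor
    · rintro (⟨j, -, -, -, h⟩ | h)
      · exact h
      · exact fun x hx hx' => h x hx (by omega)
    · intro hF
      rcases lt_or_gt_of_ne (hπ ⟨k + 1 + a, h⟩).2 with hlt | hgt
      · exact Or.inl ⟨_, rfl, hlt, trivial, hF⟩
      · refine Or.inr fun x hx hx' => ?_
        by_cases hxa : x.val < a + (k + 1)
        · exact hF x hx hxa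
        · obtain rfl : x = ⟨k + 1 + a, h⟩ := Fin.ext (by simp only; omega)
          exact hgt
  · rw [Finset.disjoint_filter]
    rintro π - ⟨j, hj, hlt, -⟩ hF
    exact lt_asymm hlt (hF j (by omega) (by omega))

theorem sum_evenBlocks {n : ℕ} (hn : 1 ≤ n) :
    ∑ π ∈ deals n, (evenBlocks π : ℝ)
      = 2 * windowCount n 0 - windowCount n 1 - 2 * altWindowCount n := by
  refine (Finset.sum_congr rfl fun π _ => ?_).trans
    ((sum_card_even_blockLen hn fun _ _ => True).trans ?_)
  · simp [evenBlocks_eq_card]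
  have hstep : ∀ k ∈ Finset.range (2 * n - 1),
      (-1 : ℝ) ^ k * ∑ a ∈ Finset.range (2 * n - 1 - k),
        (((deals n).filter fun π => ∃ j : Fin (2*n), j.val = k + 1 + a ∧
          π j < j ∧ True ∧ FirstOn π a (k + 1)).card : ℝ)
      = - ((-1) ^ (k + 1) * windowCount n (k + 1)) - (-1) ^ (k + 2) * windowCount n (k + 2) := by
    intro k hk
    rw [Finset.mem_range] at hk
    have h1 : windowCount n (k + 1) = ∑ a ∈ Finset.range (2 * n - 1 - k),
        (((2 * n - (k + 1) - a).descFactorial (k + 1) * numPairings (n - (k + 1)) : ℕ) : ℝ) := by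
      rw [windowCount, show 2 * n + 1 - (k + 1) = 2 * n - 1 - k + 1 by omega,
        Finset.sum_range_succ, show 2 * n - (k + 1) - (2 * n - 1 - k) = 0 by omega]
      simp
    have h2 : windowCount n (k + 2) = ∑ a ∈ Finset.range (2 * n - 1 - k),
        (((2 * n - (k + 2) - a).descFactorial (k + 2) * numPairings (n - (k + 2)) : ℕ) : ℝ) := by
      rw [windowCount, show 2 * n + 1 - (k + 2) = 2 * n - 1 - k by omega]
    rw [h1, h2, Finset.sum_congr rfl fun a ha => card_second_firstOn (by
      rw [Finset.mem_range] at ha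
      omega), Finset.sum_sub_distrib]
    ring
  refine (Finset.sum_congr rfl fun k hk => Eq.trans (by congr!) (hstep k hk)).trans ?_
  rw [Finset.sum_sub_distrib, Finset.sum_neg_distrib]
  have hlast : windowCount n (2 * n) = 0 := by
    rw [windowCount, show 2 * n + 1 - 2 * n = 1 by omega]
    simp
    left
    omega
  have hT1 : altWindowCount n = windowCount n 0 +
      ∑ k ∈ Finset.range (2 * n - 1), (-1 : ℝ) ^ (k + 1) * windowCount n (k + 1) := by
    rw [altWindowCount, Finset.sum_range_succ, hlast,
      show 2 * n = 2 * n - 1 + 1 by omega, Finset.sum_range_succ']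
    simp [add_comm]
  have hT2 : altWindowCount n = windowCount n 0 - windowCount n 1 +
      ∑ k ∈ Finset.range (2 * n - 1), (-1 : ℝ) ^ (k + 2) * windowCount n (k + 2) := by
    rw [altWindowCount, show 2 * n + 1 = 2 * n - 1 + 1 + 1 by omega, Finset.sum_range_succ',
      Finset.sum_range_succ']
    simp only [zero_add, pow_zero, pow_one, add_assoc]
    ring
  linarith

theorem numPairings_mul (q : ℕ) : numPairings q * (2 ^ q * q.factorial) = (2 * q).factorial := by
  induction q with
  | zero => simp [numPairings]
  | succ q ih =>
    rw [show 2 * (q + 1) = 2 * q + 1 + 1 by ring, Nat.factorial_succ (2 * q + 1),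
      Nat.factorial_succ (2 * q), ← ih, numPairings, numPairings, Finset.prod_range_succ,
      Nat.factorial_succ]
    ring

theorem sum_range_descFactorial (M k : ℕ) :
    ∑ m ∈ Finset.range M, m.descFactorial k = k.factorial * M.choose (k + 1) := by
  induction M with
  | zero => simp
  | succ M ih =>
    rw [Finset.sum_range_succ, ih, Nat.descFactorial_eq_factorial_mul_choose,
      Nat.choose_succ_succ]
    ring

theorem windowCount_eq (n k : ℕ) :
    windowCount n k
      = ((k.factorial * (2 * n + 1 - k).choose (k + 1) * numPairings (n - k) : ℕ) : ℝ) := by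
  rw [← sum_range_descFactorial, windowCount, ← Nat.cast_sum, ← Finset.sum_mul,
    ← Finset.sum_range_reflect (fun m => m.descFactorial k)]
  congr 3 with a
  congr 1
  omega

theorem windowCount_mul {n k : ℕ} (hk : k ≤ n) :
    windowCount n k * ((k + 1) * (2 ^ (n - k) * (n - k).factorial))
      = ((2 * n + 1 - k).factorial : ℝ) := by
  rw [windowCount_eq]
  norm_cast
  rw [← Nat.choose_mul_factorial_mul_factorial (show k + 1 ≤ 2 * n + 1 - k by omega),
    show 2 * n + 1 - k - (k + 1) = 2 * (n - k) by omega, ← numPairings_mul, Nat.factorial_succ]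
  ring

theorem windowCount_eq_zero {n k : ℕ} (hk : n < k) : windowCount n k = 0 := by
  rw [windowCount_eq, Nat.choose_eq_zero_of_lt (by omega)]
  simp

theorem numPairings_pos (q : ℕ) : 0 < numPairings q :=
  Finset.prod_pos fun _ _ => Nat.succ_pos _

theorem windowCount_zero (n : ℕ) : windowCount n 0 = (2 * n + 1) * numPairings n := by
  rw [windowCount_eq]
  simp

theorem windowCount_one {n : ℕ} (hn : 1 ≤ n) : windowCount n 1 = n * numPairings n := by
  obtain ⟨n, rfl⟩ : ∃ m, n = m + 1 := ⟨n - 1, by omega⟩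
  have h := windowCount_mul (show 1 ≤ n + 1 by omega)
  have h2 : ((numPairings (n + 1) * (2 ^ (n + 1) * (n + 1).factorial) : ℕ) : ℝ) = _ :=
    congrArg Nat.cast (numPairings_mul (n + 1))
  rw [Nat.add_sub_cancel, Nat.add_sub_cancel, ← h2] at h
  push_cast [Nat.factorial_succ, pow_succ] at h ⊢
  have h3 : (2 : ℝ) ^ n * n.factorial ≠ 0 := by positivity
  refine mul_right_cancel₀ h3 ?_
  linarith

theorem integral_pow_mul_one_sub_pow (k : ℕ) : ∀ m : ℕ,
    ∫ x in (0 : ℝ)..1, x ^ k * (1 - x) ^ m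
      = (k.factorial * m.factorial : ℝ) / (k + m + 1).factorial := by
  induction k with
  | zero =>
    intro m
    have h : ∀ x ∈ Set.uIcc (0 : ℝ) 1,
        HasDerivAt (fun x : ℝ => -((1 - x) ^ (m + 1) / (m + 1))) (x ^ 0 * (1 - x) ^ m) x := by
      intro x _
      have := ((((hasDerivAt_id' x).const_sub 1).fun_pow (m + 1)).div_const ((m : ℝ) + 1)).neg
      refine this.congr_deriv ?_
      have h0 : (m : ℝ) + 1 ≠ 0 := by positivity
      push_cast [Nat.add_sub_cancel]
      field_simp
    rw [intervalIntegral.integral_eq_sub_of_hasDerivAt h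
      (Continuous.intervalIntegrable (by fun_prop) _ _)]
    simp only [Nat.factorial_zero, zero_add, Nat.factorial_succ]
    push_cast
    have h1 : (m.factorial : ℝ) ≠ 0 := by positivity
    simp
    field_simp
  | succ k ih =>
    intro m
    have h : ∀ x ∈ Set.uIcc (0 : ℝ) 1,
        HasDerivAt (fun x : ℝ => x ^ (k + 1) * (1 - x) ^ (m + 1))
          ((k + 1) * (x ^ k * (1 - x) ^ (m + 1)) - (m + 1) * (x ^ (k + 1) * (1 - x) ^ m)) x := by
      intro x _
      have := ((hasDerivAt_id' x).fun_pow (k + 1)).fun_mul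
        (((hasDerivAt_id' x).const_sub 1).fun_pow (m + 1))
      refine this.congr_deriv ?_
      push_cast [Nat.add_sub_cancel]
      ring
    have h2 := intervalIntegral.integral_eq_sub_of_hasDerivAt h
      (Continuous.intervalIntegrable (by fun_prop) _ _)
    rw [intervalIntegral.integral_sub (Continuous.intervalIntegrable (by fun_prop) _ _)
      (Continuous.intervalIntegrable (by fun_prop) _ _), intervalIntegral.integral_const_mul,
      intervalIntegral.integral_const_mul, ih (m + 1)] at h2
    have h3 : ((m : ℝ) + 1) * ∫ x in (0 : ℝ)..1, x ^ (k + 1) * (1 - x) ^ m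
        = (k + 1) * ((k.factorial * (m + 1).factorial : ℝ) / (k + (m + 1) + 1).factorial) := by
      simp at h2
      linarith
    have h4 : ((m : ℝ) + 1) ≠ 0 := by positivity
    refine mul_left_cancel₀ h4 (h3.trans ?_)
    rw [show k + 1 + m + 1 = k + (m + 1) + 1 by ring]
    push_cast [Nat.factorial_succ]
    ring

/-- The polynomial `((1 - x) ^ (2 * N) - ((1 - x) * (1 - 3 * x)) ^ N) / x`. -/
noncomputable def gamePoly (N : ℕ) (x : ℝ) : ℝ :=
  ∑ k ∈ Finset.range N,
    (-1) ^ k * (2 ^ (k + 1) * (N.choose (k + 1)) * (x ^ k * (1 - x) ^ (2 * N - 1 - k)))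

theorem mul_gamePoly (N : ℕ) (x : ℝ) :
    x * gamePoly N x = ((1 - x) ^ 2) ^ N - ((1 - x) * (1 - 3 * x)) ^ N := by
  have h : ((1 - x) * (1 - 3 * x)) ^ N = (1 - x) ^ N * (-2 * x + (1 - x)) ^ N := by
    rw [mul_pow]
    congr 2
    ring
  rw [h, add_pow, Finset.sum_range_succ', gamePoly, Finset.mul_sum, mul_add, Finset.mul_sum]
  simp only [pow_zero, Nat.choose_zero_right, Nat.cast_one, mul_one, one_mul, Nat.sub_zero]
  rw [← pow_add, ← two_mul, ← pow_mul, sub_add_eq_sub_sub_swap, sub_self, zero_sub,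
    ← Finset.sum_neg_distrib]
  refine Finset.sum_congr rfl fun k hk => ?_
  rw [Finset.mem_range] at hk
  rw [show 2 * N - 1 - k = N + (N - (k + 1)) by omega, pow_add, mul_pow, neg_pow 2 (k + 1)]
  ring

theorem windowCount_eq_integral {n k : ℕ} (hk : k ≤ n) :
    windowCount n k = numPairings (n + 1) * (2 ^ (k + 1) * (n + 1).choose (k + 1) *
      ∫ x in (0 : ℝ)..1, x ^ k * (1 - x) ^ (2 * (n + 1) - 1 - k)) := by
  have h1 := windowCount_mul hk
  have h2 : ((numPairings (n + 1) * (2 ^ (n + 1) * (n + 1).factorial) : ℕ) : ℝ) = _ :=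
    congrArg Nat.cast (numPairings_mul (n + 1))
  have h3 : (((n + 1).choose (k + 1) * (k + 1).factorial * (n + 1 - (k + 1)).factorial : ℕ) : ℝ)
      = _ := congrArg Nat.cast (Nat.choose_mul_factorial_mul_factorial (by omega))
  rw [integral_pow_mul_one_sub_pow, show 2 * (n + 1) - 1 - k = 2 * n + 1 - k by omega,
    show k + (2 * n + 1 - k) + 1 = 2 * (n + 1) by omega, ← h1, ← h2]
  rw [Nat.add_sub_add_right] at h3
  have h4 : (2 : ℝ) ^ (n + 1) = 2 ^ (k + 1) * 2 ^ (n - k) := by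
    rw [← pow_add]
    congr 1
    omega
  push_cast [Nat.factorial_succ k] at h3 ⊢
  rw [h4, ← h3]
  have h5 : ((n - k).factorial : ℝ) ≠ 0 := by positivity
  have h6 : (k.factorial : ℝ) ≠ 0 := by positivity
  have h7 : ((n + 1).choose (k + 1) : ℝ) ≠ 0 := by
    exact_mod_cast (Nat.choose_pos (by omega)).ne'
  have h8 : (numPairings (n + 1) : ℝ) ≠ 0 := by exact_mod_cast (numPairings_pos _).ne'
  have h9 : (k : ℝ) + 1 ≠ 0 := by positivity
  field_simp

theorem altWindowCount_eq (n : ℕ) :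
    altWindowCount n = numPairings (n + 1) * ∫ x in (0 : ℝ)..1, gamePoly (n + 1) x := by
  have hsum : altWindowCount n = ∑ k ∈ Finset.range (n + 1), (-1 : ℝ) ^ k * windowCount n k := by
    refine (Finset.sum_subset ?_ fun k hk hk' => ?_).symm
    · intro k
      simp only [Finset.mem_range]
      omega
    · simp only [Finset.mem_range] at hk hk'
      rw [windowCount_eq_zero (by omega), mul_zero]
  simp only [gamePoly]
  rw [hsum, intervalIntegral.integral_finsetSum
    fun k _ => Continuous.intervalIntegrable (by fun_prop) _ _, Finset.mul_sum]
  refine Finset.sum_congr rfl fun k hk => ?_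
  rw [Finset.mem_range] at hk
  rw [windowCount_eq_integral (by omega), intervalIntegral.integral_const_mul,
    intervalIntegral.integral_const_mul]
  ring

theorem gamePoly_eq {N : ℕ} {x : ℝ} (hx : x ∈ Set.Ioc (0 : ℝ) 1) :
    gamePoly N x
      = ∑ i ∈ Finset.range N, ((4 - 6 * x) * ((1 - x) * (1 - 3 * x)) ^ i
          - (2 - 2 * x) * ((1 - x) ^ 2) ^ i)
        + (3 / (4 - 3 * x) - 1 / (2 - x))
        - (3 / (4 - 3 * x) * ((1 - x) * (1 - 3 * x)) ^ N
          - 1 / (2 - x) * ((1 - x) ^ 2) ^ N) := by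
  have h0 : x ≠ 0 := hx.1.ne'
  have h1 : 4 - 3 * x ≠ 0 := by linarith [hx.2]
  have h2 : 2 - x ≠ 0 := by linarith [hx.2]
  refine mul_left_cancel₀ h0 ?_
  rw [mul_gamePoly, Finset.sum_sub_distrib, ← Finset.mul_sum, ← Finset.mul_sum]
  have hu := mul_neg_geom_sum ((1 - x) * (1 - 3 * x)) N
  have hw := mul_neg_geom_sum ((1 - x) ^ 2) N
  set u := ((1 - x) * (1 - 3 * x)) ^ N
  set w := ((1 - x) ^ 2) ^ N
  set U := ∑ i ∈ Finset.range N, ((1 - x) * (1 - 3 * x)) ^ i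
  set V := ∑ i ∈ Finset.range N, ((1 - x) ^ 2) ^ i
  have hu' : u = 1 - (1 - (1 - x) * (1 - 3 * x)) * U := by linarith
  have hw' : w = 1 - (1 - (1 - x) ^ 2) * V := by linarith
  have hp : 3 / (4 - 3 * x) * (4 - 3 * x) = 3 := div_mul_cancel₀ _ h1
  have hq : 1 / (2 - x) * (2 - x) = 1 := div_mul_cancel₀ _ h2
  rw [hu', hw']
  linear_combination (-x ^ 2 * U) * hp + (x ^ 2 * V) * hq

theorem integral_mul_one_sub_half_pow_le (N : ℕ) :
    ∫ x in (0 : ℝ)..1, x * (1 - x / 2) ^ N ≤ 4 / ((N + 1) * (N + 2)) := by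
  have h : ∀ x ∈ Set.uIcc (0 : ℝ) 1,
      HasDerivAt (fun x : ℝ => 4 * ((1 - x / 2) ^ (N + 2) / (N + 2))
        - 4 * ((1 - x / 2) ^ (N + 1) / (N + 1))) (x * (1 - x / 2) ^ N) x := by
    intro x _
    have hs := ((hasDerivAt_id' x).div_const 2).const_sub 1
    have := (((hs.fun_pow (N + 2)).div_const ((N : ℝ) + 2)).const_mul 4).fun_sub
      (((hs.fun_pow (N + 1)).div_const ((N : ℝ) + 1)).const_mul 4)
    refine this.congr_deriv ?_
    rw [show N + 2 - 1 = N + 1 by omega, Nat.add_sub_cancel]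
    push_cast
    have h1 : (N : ℝ) + 1 ≠ 0 := by positivity
    have h2 : (N : ℝ) + 2 ≠ 0 := by positivity
    field_simp
    ring
  rw [intervalIntegral.integral_eq_sub_of_hasDerivAt h
    (Continuous.intervalIntegrable (by fun_prop) _ _)]
  have h1 : (0 : ℝ) < (N : ℝ) + 1 := by positivity
  have h2 : (0 : ℝ) < (N : ℝ) + 2 := by positivity
  have h3 : (1 - (1 : ℝ) / 2) ^ (N + 2) / ((N : ℝ) + 2)
      ≤ (1 - (1 : ℝ) / 2) ^ (N + 1) / ((N : ℝ) + 1) :=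
    div_le_div₀ (by positivity) (pow_le_pow_of_le_one (by norm_num) (by norm_num) (by omega)) h1
      (by linarith)
  have h4 : (4 : ℝ) / ((N + 1) * (N + 2)) = 4 * (1 / (N + 1)) - 4 * (1 / (N + 2)) := by
    field_simp
    ring
  rw [h4]
  simp only [zero_div, sub_zero, one_pow]
  linarith

/-- The Laplace method at the endpoint `0`, by comparison with the derivative of a power of `v`. -/
theorem tendsto_mul_integral_mul_pow {f v v' : ℝ → ℝ} {c C : ℝ} (hC : 0 ≤ C)
    (hf : ContinuousOn f (Set.Icc 0 1)) (hv : ∀ x, HasDerivAt v (v' x) x) (hv' : Continuous v')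
    (hv0 : v 0 = 1) (hv1 : v 1 = 0) (hle : ∀ x ∈ Set.Icc (0 : ℝ) 1, |v x| ≤ 1 - x / 2)
    (hfv : ∀ x ∈ Set.Icc (0 : ℝ) 1, |f x + c * v' x| ≤ C * x) :
    Tendsto (fun N : ℕ => (N : ℝ) * ∫ x in (0 : ℝ)..1, f x * v x ^ N) atTop (nhds c) := by
  have hvc : Continuous v := continuous_iff_continuousAt.2 fun x => (hv x).continuousAt
  have hmain : ∀ N : ℕ, ∫ x in (0 : ℝ)..1, v' x * v x ^ N = -(1 / (N + 1)) := by
    intro N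
    have h : ∀ x ∈ Set.uIcc (0 : ℝ) 1,
        HasDerivAt (fun x => v x ^ (N + 1) / ((N : ℝ) + 1)) (v' x * v x ^ N) x := by
      intro x _
      refine (((hv x).fun_pow (N + 1)).div_const ((N : ℝ) + 1)).congr_deriv ?_
      have h1 : (N : ℝ) + 1 ≠ 0 := by positivity
      push_cast [Nat.add_sub_cancel]
      field_simp
    rw [intervalIntegral.integral_eq_sub_of_hasDerivAt h
      (Continuous.intervalIntegrable (by fun_prop) _ _), hv0, hv1]
    simp
  have herr : ∀ N : ℕ, |∫ x in (0 : ℝ)..1, (f x + c * v' x) * v x ^ N|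
      ≤ C * (4 / ((N + 1) * (N + 2))) := by
    intro N
    rw [← Real.norm_eq_abs]
    refine le_trans (intervalIntegral.norm_integral_le_of_norm_le zero_le_one
      (g := fun x => C * (x * (1 - x / 2) ^ N)) ?_
      (Continuous.intervalIntegrable (by fun_prop) _ _)) ?_
    · refine Filter.Eventually.of_forall fun x hx => ?_
      have hx' : x ∈ Set.Icc (0 : ℝ) 1 := ⟨hx.1.le, hx.2⟩
      rw [Real.norm_eq_abs, abs_mul, abs_pow, ← mul_assoc]
      exact mul_le_mul (hfv x hx') (pow_le_pow_left₀ (abs_nonneg _) (hle x hx') N)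
        (by positivity) (mul_nonneg hC hx.1.le)
    · rw [intervalIntegral.integral_const_mul]
      exact mul_le_mul_of_nonneg_left (integral_mul_one_sub_half_pow_le N) hC
  have hsplit : ∀ N : ℕ, (N : ℝ) * ∫ x in (0 : ℝ)..1, f x * v x ^ N
      = c * (N / (N + 1)) + N * ∫ x in (0 : ℝ)..1, (f x + c * v' x) * v x ^ N := by
    intro N
    have hfint : IntervalIntegrable (fun x => f x * v x ^ N) MeasureTheory.volume 0 1 := by
      refine ContinuousOn.intervalIntegrable ?_
      rw [Set.uIcc_of_le zero_le_one]
      fun_prop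
    have : ∀ x, (f x + c * v' x) * v x ^ N = f x * v x ^ N + c * (v' x * v x ^ N) :=
      fun x => by ring
    simp only [this]
    rw [intervalIntegral.integral_add hfint (Continuous.intervalIntegrable (by fun_prop) _ _),
      intervalIntegral.integral_const_mul, hmain]
    ring
  simp only [hsplit]
  have hlim : Tendsto (fun N : ℕ => c * ((N : ℝ) / (N + 1))) atTop (nhds (c * 1)) :=
    (tendsto_natCast_div_add_atTop 1).const_mul c
  have hsmall : Tendsto (fun N : ℕ => (N : ℝ) * ∫ x in (0 : ℝ)..1, (f x + c * v' x) * v x ^ N)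
      atTop (nhds 0) := by
    have hz : Tendsto (fun N : ℕ => 4 * C * (1 / ((N : ℝ) + 1))) atTop (nhds (4 * C * 0)) :=
      tendsto_one_div_add_atTop_nhds_zero_nat.const_mul _
    rw [mul_zero] at hz
    refine squeeze_zero_norm (fun N => ?_) hz
    rw [Real.norm_eq_abs, abs_mul, Nat.abs_cast]
    refine (mul_le_mul_of_nonneg_left (herr N) (Nat.cast_nonneg N)).trans ?_
    have h1 : (N : ℝ) / (N + 2) ≤ 1 := by
      rw [div_le_one (by positivity)]
      linarith
    calc (N : ℝ) * (C * (4 / ((N + 1) * (N + 2))))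
        = 4 * C * (1 / ((N : ℝ) + 1)) * (N / (N + 2)) := by field_simp
      _ ≤ 4 * C * (1 / ((N : ℝ) + 1)) * 1 := by gcongr
      _ = _ := mul_one _
  simpa using hlim.add hsmall

theorem integral_gamePoly (N : ℕ) :
    ∫ x in (0 : ℝ)..1, gamePoly N x
      = Real.log 2 - ((∫ x in (0 : ℝ)..1, 3 / (4 - 3 * x) * ((1 - x) * (1 - 3 * x)) ^ N)
        - ∫ x in (0 : ℝ)..1, 1 / (2 - x) * ((1 - x) ^ 2) ^ N) := by
  have hcont : ∀ {g : ℝ → ℝ}, ContinuousOn g (Set.Icc 0 1) →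
      IntervalIntegrable g MeasureTheory.volume 0 1 := fun hg => by
    refine ContinuousOn.intervalIntegrable ?_
    rwa [Set.uIcc_of_le zero_le_one]
  have hne1 : ∀ x ∈ Set.Icc (0 : ℝ) 1, 4 - 3 * x ≠ 0 := fun x hx => by linarith [hx.2]
  have hne2 : ∀ x ∈ Set.Icc (0 : ℝ) 1, 2 - x ≠ 0 := fun x hx => by linarith [hx.2]
  have hc1 : ContinuousOn (fun x : ℝ => 3 / (4 - 3 * x)) (Set.Icc 0 1) :=
    continuousOn_const.div (by fun_prop) hne1
  have hc2 : ContinuousOn (fun x : ℝ => 1 / (2 - x)) (Set.Icc 0 1) :=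
    continuousOn_const.div (by fun_prop) hne2
  have hlog : ∫ x in (0 : ℝ)..1, (3 / (4 - 3 * x) - 1 / (2 - x)) = Real.log 2 := by
    have h : ∀ x ∈ Set.uIcc (0 : ℝ) 1,
        HasDerivAt (fun x : ℝ => Real.log (2 - x) - Real.log (4 - 3 * x))
          (3 / (4 - 3 * x) - 1 / (2 - x)) x := by
      intro x hx
      rw [Set.uIcc_of_le zero_le_one] at hx
      have := (((hasDerivAt_id' x).const_sub 2).log (hne2 x hx)).fun_sub
        ((((hasDerivAt_id' x).const_mul 3).const_sub 4).log (hne1 x hx))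
      refine this.congr_deriv ?_
      ring
    rw [intervalIntegral.integral_eq_sub_of_hasDerivAt h (hcont (hc1.sub hc2)),
      show (4 : ℝ) - 3 * 0 = 2 * 2 by norm_num, Real.log_mul two_ne_zero two_ne_zero]
    norm_num
  have hpow : ∫ x in (0 : ℝ)..1, ∑ i ∈ Finset.range N,
      ((4 - 6 * x) * ((1 - x) * (1 - 3 * x)) ^ i - (2 - 2 * x) * ((1 - x) ^ 2) ^ i) = 0 := by
    rw [intervalIntegral.integral_finsetSum
      fun k _ => Continuous.intervalIntegrable (by fun_prop) _ _]
    refine Finset.sum_eq_zero fun i _ => ?_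
    have h : ∀ x ∈ Set.uIcc (0 : ℝ) 1,
        HasDerivAt (fun x : ℝ => (((1 - x) ^ 2) ^ (i + 1) - ((1 - x) * (1 - 3 * x)) ^ (i + 1))
          / ((i : ℝ) + 1))
        ((4 - 6 * x) * ((1 - x) * (1 - 3 * x)) ^ i - (2 - 2 * x) * ((1 - x) ^ 2) ^ i) x := by
      intro x _
      have h1 := (hasDerivAt_id' x).const_sub 1
      have h2 := ((hasDerivAt_id' x).const_mul 3).const_sub 1
      have := (((h1.fun_pow 2).fun_pow (i + 1)).fun_sub
        ((h1.fun_mul h2).fun_pow (i + 1))).div_const ((i : ℝ) + 1)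
      refine this.congr_deriv ?_
      have h0 : (i : ℝ) + 1 ≠ 0 := by positivity
      rw [Nat.add_sub_cancel, div_eq_iff h0]
      push_cast
      ring
    rw [intervalIntegral.integral_eq_sub_of_hasDerivAt h
      (Continuous.intervalIntegrable (by fun_prop) _ _)]
    simp
  have hi0 : IntervalIntegrable (fun x : ℝ => ∑ i ∈ Finset.range N,
      ((4 - 6 * x) * ((1 - x) * (1 - 3 * x)) ^ i - (2 - 2 * x) * ((1 - x) ^ 2) ^ i))
      MeasureTheory.volume 0 1 := Continuous.intervalIntegrable (by fun_prop) _ _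
  have hi1 : IntervalIntegrable (fun x : ℝ => 3 / (4 - 3 * x) * ((1 - x) * (1 - 3 * x)) ^ N)
      MeasureTheory.volume 0 1 := hcont (by fun_prop)
  have hi2 : IntervalIntegrable (fun x : ℝ => 1 / (2 - x) * ((1 - x) ^ 2) ^ N)
      MeasureTheory.volume 0 1 := hcont (by fun_prop)
  have hi3 : IntervalIntegrable (fun x : ℝ => 3 / (4 - 3 * x) - 1 / (2 - x))
      MeasureTheory.volume 0 1 := hcont (hc1.sub hc2)
  have hsum := intervalIntegral.integral_add hi0 hi3
  rw [hpow, hlog, zero_add] at hsum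
  rw [← intervalIntegral.integral_sub hi1 hi2, ← hsum,
    ← intervalIntegral.integral_sub (hi0.add hi3) (hi1.sub hi2)]
  refine intervalIntegral.integral_congr_ae (Filter.Eventually.of_forall fun x hx => ?_)
  rw [Set.uIoc_of_le zero_le_one] at hx
  exact gamePoly_eq hx

theorem tendsto_integral_gamePoly :
    Tendsto (fun N : ℕ => (N : ℝ) * ((∫ x in (0 : ℝ)..1, gamePoly N x) - Real.log 2))
      atTop (nhds (1 / 16)) := by
  have h1 : Tendsto (fun N : ℕ => (N : ℝ) *
      ∫ x in (0 : ℝ)..1, 3 / (4 - 3 * x) * ((1 - x) * (1 - 3 * x)) ^ N) atTop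
      (nhds (3 / 16)) := by
    refine tendsto_mul_integral_mul_pow (v' := fun x => -(4 - 6 * x)) (C := 27 / 8)
      (by norm_num) (continuousOn_const.div (by fun_prop) fun x hx => by linarith [hx.2])
      (fun x => ?_) (by fun_prop) (by norm_num) (by norm_num) (fun x hx => ?_) fun x hx => ?_
    · have := ((hasDerivAt_id' x).const_sub 1).fun_mul
        (((hasDerivAt_id' x).const_mul 3).const_sub 1)
      refine this.congr_deriv ?_
      ring
    · rw [abs_le]
      constructor <;> nlinarith [hx.1, hx.2, sq_nonneg (x - 3 / 4)]
    · have h4 : 0 < 4 - 3 * x := by linarith [hx.2]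
      have : 3 / (4 - 3 * x) + 3 / 16 * -(4 - 6 * x) = x * (9 / 4 / (4 - 3 * x) + 9 / 8) := by
        field_simp
        ring
      have h5 : 9 / 4 / (4 - 3 * x) ≤ 9 / 4 := div_le_self (by norm_num) (by linarith [hx.2])
      have h6 : 0 ≤ 9 / 4 / (4 - 3 * x) := by positivity
      rw [this, abs_of_nonneg (mul_nonneg hx.1 (by linarith))]
      nlinarith [hx.1]
  have h2 : Tendsto (fun N : ℕ => (N : ℝ) *
      ∫ x in (0 : ℝ)..1, 1 / (2 - x) * ((1 - x) ^ 2) ^ N) atTop (nhds (1 / 4)) := by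
    refine tendsto_mul_integral_mul_pow (v := fun x => (1 - x) ^ 2)
      (v' := fun x => -(2 * (1 - x))) (C := 1)
      (by norm_num) (continuousOn_const.div (by fun_prop) fun x hx => by linarith [hx.2])
      (fun x => ?_) (by fun_prop) (by norm_num) (by norm_num) (fun x hx => ?_) fun x hx => ?_
    · refine (((hasDerivAt_id' x).const_sub 1).fun_pow 2).congr_deriv ?_
      norm_num
    · rw [abs_of_nonneg (sq_nonneg _)]
      nlinarith [hx.1, hx.2]
    · have h4 : 0 < 2 - x := by linarith [hx.2]
      have : 1 / (2 - x) + 1 / 4 * -(2 * (1 - x)) = x * (1 / 2 / (2 - x) + 1 / 2) := by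
        field_simp
        ring
      have h5 : 1 / 2 / (2 - x) ≤ 1 / 2 := div_le_self (by norm_num) (by linarith [hx.2])
      have h6 : 0 ≤ 1 / 2 / (2 - x) := by positivity
      rw [this, abs_of_nonneg (mul_nonneg hx.1 (by linarith))]
      nlinarith [hx.1]
  have h3 := h2.sub h1
  norm_num at h3
  refine h3.congr fun N => ?_
  rw [integral_gamePoly]
  norm_num
  ring

theorem numPairings_succ (n : ℕ) : numPairings (n + 1) = numPairings n * (2 * n + 1) :=
  Finset.prod_range_succ _ _

theorem tendsto_integral_gamePoly_sub_log_two :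
    Tendsto (fun N : ℕ => (∫ x in (0 : ℝ)..1, gamePoly N x) - Real.log 2) atTop (nhds 0) := by
  have h := tendsto_one_div_atTop_nhds_zero_nat.mul tendsto_integral_gamePoly
  rw [zero_mul] at h
  refine h.congr' ?_
  filter_upwards [eventually_ge_atTop 1] with N hN
  have : (N : ℝ) ≠ 0 := by positivity
  field_simp

/-- The expected length of an optimally played solitaire memory game with `n`
pairs is `(3 - 2 ln 2) n + 7/8 - 2 ln 2 + ε_n` with `ε_n → 0`. -/
theorem expected_game_length :
    Tendsto (fun n : ℕ =>
        (3*(n:ℝ)/2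
          + (1/(2*((deals n).card : ℝ))) * ∑ π ∈ deals n, (evenBlocks π : ℝ)
          - (1/((deals n).card : ℝ)) * ∑ π ∈ deals n, (luckyEvenBlocks π : ℝ))
        - ((3 - 2*Real.log 2)*(n:ℝ) + 7/8 - 2*Real.log 2))
      atTop (nhds 0) := by
  have h1 := (tendsto_add_atTop_iff_nat 1).2 tendsto_integral_gamePoly
  have h2 := tendsto_integral_gamePoly_sub_log_two
  have h3 := (tendsto_add_atTop_iff_nat 1).2 h2
  have h := (((h1.const_mul 2).const_sub (1 / 8)).add h3).sub h2
  norm_num at h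
  refine h.congr' ?_
  filter_upwards [eventually_ge_atTop 1] with n hn
  have hD : (numPairings n : ℝ) ≠ 0 := by exact_mod_cast (numPairings_pos n).ne'
  have hlucky : ∑ π ∈ deals n, (luckyEvenBlocks π : ℝ)
      = numPairings n * ∫ x in (0 : ℝ)..1, gamePoly n x := by
    obtain ⟨m, rfl⟩ := Nat.exists_eq_add_of_le' hn
    rw [sum_luckyEvenBlocks, altWindowCount_eq]
  rw [hlucky, sum_evenBlocks hn, altWindowCount_eq, windowCount_zero, windowCount_one hn,
    numPairings_succ, card_deals]
  push_cast
  field_simp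
  ring
end

section
/- The infinite series ∑_{i=1}^∞ 2/((2i)·(2i+1)·(2i+2)) converges, with sum 3/2 − 2·ln 2. -/
open Filter Topology in
/-- The difference of harmonic numbers `H_{2n+1} - H_n` tends to `log 2`. -/
theorem tendsto_harmonic_two_mul_add_one_sub_harmonic :
    Tendsto (fun n : ℕ => (harmonic (2 * n + 1) : ℝ) - harmonic n) atTop (𝓝 (Real.log 2)) := by
  have h := Real.tendsto_harmonic_sub_log_add_one
  have hodd : Tendsto (fun n : ℕ => 2 * n + 1) atTop atTop :=
    tendsto_atTop_mono (fun n => by dsimp only [id]; omega) tendsto_id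
  have hdiff := ((h.comp hodd).sub h).add_const (Real.log 2)
  simp only [sub_self, zero_add] at hdiff
  refine hdiff.congr fun n => ?_
  have hn : (n : ℝ) + 1 ≠ 0 := by positivity
  have hlog : Real.log (((2 * n + 1 : ℕ) : ℝ) + 1) = Real.log 2 + Real.log ((n : ℝ) + 1) := by
    rw [← Real.log_mul two_ne_zero hn]
    congr 1
    push_cast
    ring
  simp only [Function.comp_apply, hlog]
  ring

/-- The partial sums of `∑ 2/((2i)(2i+1)(2i+2))` in terms of harmonic numbers. -/
theorem sum_range_even_partial_fractions (n : ℕ) :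
    ∑ i ∈ Finset.range n,
        2 / ((2*((i:ℝ)+1)) * (2*((i:ℝ)+1)+1) * (2*((i:ℝ)+1)+2)) =
      3/2 - 2 * ((harmonic (2 * n + 1) : ℝ) - harmonic n) + 1 / 2 * (1 / ((n : ℝ) + 1)) := by
  induction n with
  | zero => norm_num [harmonic_succ]
  | succ n ih =>
    rw [Finset.sum_range_succ, ih, show 2 * (n + 1) + 1 = 2 * n + 1 + 1 + 1 by ring,
      harmonic_succ (2 * n + 1 + 1), harmonic_succ (2 * n + 1), harmonic_succ n]
    push_cast
    have h₁ : (n : ℝ) + 1 ≠ 0 := by positivity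
    have h₂ : (n : ℝ) + 1 + 1 ≠ 0 := by positivity
    have h₃ : 2 * (n : ℝ) + 1 + 1 + 1 ≠ 0 := by positivity
    rw [show 2 * ((n : ℝ) + 1) + 1 = 2 * n + 1 + 1 + 1 by ring,
      show 2 * ((n : ℝ) + 1) + 2 = 2 * (n + 1 + 1) by ring,
      show 2 * (n : ℝ) + 1 + 1 = 2 * (n + 1) by ring]
    field_simp
    ring

/-- `∑_{i=1}^∞ 2/((2i)(2i+1)(2i+2)) = 3/2 - 2 ln 2`. -/
theorem sum_even_partial_fractions :
    HasSum (fun i : ℕ =>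
        2 / ((2*((i:ℝ)+1)) * (2*((i:ℝ)+1)+1) * (2*((i:ℝ)+1)+2)))
      (3/2 - 2*Real.log 2) := by
  rw [hasSum_iff_tendsto_nat_of_nonneg fun i => by positivity]
  simp only [sum_range_even_partial_fractions]
  simpa only [mul_zero, add_zero] using
    ((tendsto_harmonic_two_mul_add_one_sub_harmonic.const_mul 2).const_sub (3/2)).add
      ((tendsto_one_div_add_atTop_nhds_zero_nat (𝕜 := ℝ)).const_mul (1 / 2))
end
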